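/- arXiv:1703.07817 — 6 statements merged into one kernel-verified Lean document; each statement's English description precedes it below -/
import Mathlib

section
/- Let X is a Banach space and let (Ω, F, P) be a probability space with a filtration F = (F_t)_{t≥0} satisfying the usual conditions (i.e., the filtration is right-continuous and F_0 contains all P-null sets). Then every X-valued martingale M : ℝ₊ × Ω → X (each M_t Bochner integrable, E(M_t | F_s) = M_s for s ≤ t) admits a càdlàg version: there exists a process N : ℝ₊ × Ω → X such that for each t ≥ 0, N_t = M_t almost surely, and almost every path s ↦ N_s(ω) is right-continuous with left limits. -/
open MeasureTheory Filter Topology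
open scoped NNReal

open Set

/-- The dyadic number `i / 2 ^ n`. -/
noncomputable def dyadic (n i : ℕ) : ℝ≥0 := i / 2 ^ n

/-- The set of nonnegative dyadic numbers. -/
def dyadics : Set ℝ≥0 := ⋃ n, range (dyadic n)

lemma dyadic_strictMono (n : ℕ) : StrictMono (dyadic n) := by
  intro i j hij
  unfold dyadic
  gcongr

@[simp] lemma dyadic_zero (n : ℕ) : dyadic n 0 = 0 := by simp [dyadic]

lemma dyadic_succ (n i : ℕ) : dyadic (n + 1) (2 * i) = dyadic n i := by
  unfold dyadic
  rw [pow_succ']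
  push_cast
  rw [mul_div_mul_left _ _ two_ne_zero]

lemma monotone_range_dyadic : Monotone fun n => range (dyadic n) := by
  refine monotone_nat_of_le_succ fun n => ?_
  rintro _ ⟨i, rfl⟩
  exact ⟨2 * i, dyadic_succ n i⟩

lemma countable_dyadics : dyadics.Countable :=
  countable_iUnion fun _ => countable_range _

/-- The smallest dyadic number of level `n` that is strictly larger than `t`. -/
noncomputable def dyadicAbove (t : ℝ≥0) (n : ℕ) : ℝ≥0 := dyadic n (⌊t * 2 ^ n⌋₊ + 1)

lemma dyadicAbove_mem (t : ℝ≥0) (n : ℕ) : dyadicAbove t n ∈ dyadics :=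
  mem_iUnion.2 ⟨n, mem_range_self _⟩

lemma lt_dyadicAbove (t : ℝ≥0) (n : ℕ) : t < dyadicAbove t n := by
  unfold dyadicAbove dyadic
  rw [lt_div_iff₀ (by positivity)]
  push_cast
  exact Nat.lt_floor_add_one _

lemma dyadicAbove_le (t : ℝ≥0) (n : ℕ) : dyadicAbove t n ≤ t + 2⁻¹ ^ n := by
  unfold dyadicAbove dyadic
  rw [div_le_iff₀ (by positivity), add_mul, ← mul_pow, inv_mul_cancel₀ two_ne_zero, one_pow]
  push_cast
  gcongr
  exact Nat.floor_le zero_le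

lemma tendsto_dyadicAbove (t : ℝ≥0) : Tendsto (dyadicAbove t) atTop (𝓝 t) := by
  refine tendsto_of_tendsto_of_tendsto_of_le_of_le tendsto_const_nhds ?_
    (fun n => (lt_dyadicAbove t n).le) (dyadicAbove_le t)
  have : Tendsto (fun n : ℕ => (2⁻¹ : ℝ≥0) ^ n) atTop (𝓝 0) :=
    tendsto_pow_atTop_nhds_zero_of_lt_one zero_le (by
      rw [inv_lt_one₀ two_pos]; exact one_lt_two)
  simpa using this.const_add t

lemma tendsto_dyadicAbove_nhdsWithin (t : ℝ≥0) :
    Tendsto (dyadicAbove t) atTop (𝓝[dyadics ∩ Ioi t] t) :=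
  tendsto_nhdsWithin_iff.2 ⟨tendsto_dyadicAbove t,
    Eventually.of_forall fun n => ⟨dyadicAbove_mem t n, lt_dyadicAbove t n⟩⟩

instance neBot_nhdsWithin_dyadics_inter_Ioi (t : ℝ≥0) : (𝓝[dyadics ∩ Ioi t] t).NeBot :=
  (tendsto_dyadicAbove_nhdsWithin t).neBot

/-- The restriction of `f` to `D` has one-sided limits at every point. -/
def HasOneSidedLimitsOn {X : Type*} [TopologicalSpace X] (D : Set ℝ≥0) (f : ℝ≥0 → X) : Prop :=
  ∀ t, (∃ L, Tendsto f (𝓝[D ∩ Iio t] t) (𝓝 L)) ∧ (∃ L, Tendsto f (𝓝[D ∩ Ioi t] t) (𝓝 L))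

lemma exists_tendsto_of_forall_eventually_dist_le {ι X : Type*} [PseudoMetricSpace X]
    [CompleteSpace X] [Nonempty X] {l : Filter ι} {f : ι → X}
    (h : ∀ ε > 0, ∃ (g : ι → X) (L : X), Tendsto g l (𝓝 L) ∧ ∀ᶠ i in l, dist (f i) (g i) ≤ ε) :
    ∃ L, Tendsto f l (𝓝 L) := by
  rcases l.eq_or_neBot with rfl | hl
  · exact ⟨Classical.arbitrary X, tendsto_bot⟩
  refine cauchy_map_iff_exists_tendsto.1 (Metric.cauchy_iff.2 ⟨inferInstance, fun ε hε => ?_⟩)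
  obtain ⟨g, L, hg, hfg⟩ := h (ε / 8) (by positivity)
  have hgL := hg.eventually (Metric.ball_mem_nhds L (show 0 < ε / 8 by positivity))
  refine ⟨f '' {i | dist (f i) (g i) ≤ ε / 8 ∧ g i ∈ Metric.ball L (ε / 8)},
    image_mem_map (hfg.and hgL), ?_⟩
  rintro _ ⟨i, ⟨hi, hi'⟩, rfl⟩ _ ⟨j, ⟨hj, hj'⟩, rfl⟩
  rw [Metric.mem_ball] at hi' hj'
  have h1 := dist_triangle (f i) (g i) L
  have h2 := dist_triangle (f j) (g j) L
  have h3 := dist_triangle_right (f i) (f j) L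
  linarith

lemma HasOneSidedLimitsOn.of_forall_dist_le {X : Type*} [PseudoMetricSpace X] [CompleteSpace X]
    [Nonempty X] {D : Set ℝ≥0} {f : ℝ≥0 → X}
    (h : ∀ ε > 0, ∃ g : ℝ≥0 → X, HasOneSidedLimitsOn D g ∧ ∀ s ∈ D, dist (f s) (g s) ≤ ε) :
    HasOneSidedLimitsOn D f := by
  refine fun t => ⟨?_, ?_⟩ <;>
  · refine exists_tendsto_of_forall_eventually_dist_le fun ε hε => ?_
    obtain ⟨g, hg, hfg⟩ := h ε hε
    first
    | obtain ⟨L, hL⟩ := (hg t).1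
      exact ⟨g, L, hL, eventually_mem_nhdsWithin.mono fun s hs => hfg s hs.1⟩
    | obtain ⟨L, hL⟩ := (hg t).2
      exact ⟨g, L, hL, eventually_mem_nhdsWithin.mono fun s hs => hfg s hs.1⟩

lemma HasOneSidedLimitsOn.congr {X : Type*} [TopologicalSpace X] {D : Set ℝ≥0} {f g : ℝ≥0 → X}
    (hf : HasOneSidedLimitsOn D f) (h : EqOn f g D) : HasOneSidedLimitsOn D g := by
  refine fun t => ⟨(hf t).1.imp fun L hL => ?_, (hf t).2.imp fun L hL => ?_⟩ <;>
  exact hL.congr' (eventually_mem_nhdsWithin.mono fun s hs => h hs.1)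

/-- The right-limit path `t ↦ lim_{s ↓ t, s ∈ dyadics} f s`. -/
noncomputable def rightLimPath {X : Type*} [TopologicalSpace X] [Nonempty X] (f : ℝ≥0 → X)
    (t : ℝ≥0) : X :=
  limUnder (𝓝[dyadics ∩ Ioi t] t) f

section rightLimPath

variable {X : Type*} [TopologicalSpace X] [Nonempty X] {f : ℝ≥0 → X}

lemma HasOneSidedLimitsOn.tendsto_rightLimPath (hf : HasOneSidedLimitsOn dyadics f) (t : ℝ≥0) :
    Tendsto f (𝓝[dyadics ∩ Ioi t] t) (𝓝 (rightLimPath f t)) :=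
  tendsto_nhds_limUnder (hf t).2

lemma HasOneSidedLimitsOn.rightLimPath_mem (hf : HasOneSidedLimitsOn dyadics f) {U : Set ℝ≥0}
    {C : Set X} (hU : IsOpen U) (hC : IsClosed C) (h : ∀ s ∈ dyadics ∩ U, f s ∈ C) {t : ℝ≥0}
    (ht : t ∈ U) : rightLimPath f t ∈ C := by
  refine hC.mem_of_tendsto (hf.tendsto_rightLimPath t) ?_
  filter_upwards [eventually_mem_nhdsWithin, mem_nhdsWithin_of_mem_nhds (hU.mem_nhds ht)]
    with s hs hsU using h s ⟨hs.1, hsU⟩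

lemma HasOneSidedLimitsOn.rightLimPath_tendsto [RegularSpace X]
    (hf : HasOneSidedLimitsOn dyadics f) {V : Set ℝ≥0} (hV : IsOpen V) {t : ℝ≥0} {L : X}
    (h : Tendsto f (𝓝[dyadics ∩ V] t) (𝓝 L)) :
    Tendsto (rightLimPath f) (𝓝[V] t) (𝓝 L) := by
  refine (closed_nhds_basis L).tendsto_right_iff.2 fun C ⟨hCL, hC⟩ => ?_
  obtain ⟨U, hU, htU, hUC⟩ := mem_nhdsWithin.1 (h hCL)
  filter_upwards [mem_nhdsWithin_of_mem_nhds (hU.mem_nhds htU), self_mem_nhdsWithin] with s hsU hsV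
  exact hf.rightLimPath_mem (hU.inter hV) hC (fun r hr => hUC ⟨hr.2.1, hr.1, hr.2.2⟩) ⟨hsU, hsV⟩

lemma HasOneSidedLimitsOn.continuousWithinAt_rightLimPath [RegularSpace X]
    (hf : HasOneSidedLimitsOn dyadics f) (t : ℝ≥0) :
    ContinuousWithinAt (rightLimPath f) (Ici t) t :=
  continuousWithinAt_Ioi_iff_Ici.1 (hf.rightLimPath_tendsto isOpen_Ioi (hf.tendsto_rightLimPath t))

lemma HasOneSidedLimitsOn.exists_tendsto_rightLimPath_left [RegularSpace X]
    (hf : HasOneSidedLimitsOn dyadics f) (t : ℝ≥0) :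
    ∃ L, Tendsto (rightLimPath f) (𝓝[<] t) (𝓝 L) :=
  (hf t).1.imp fun _ hL => hf.rightLimPath_tendsto isOpen_Iio hL

end rightLimPath

/-- After time `s`, the path `f` makes at least `k` upcrossings of `[a, b]` along points of `D`. -/
def HasUpcrossings (f : ℝ≥0 → ℝ) (a b : ℝ) (D : Set ℝ≥0) : ℕ → ℝ≥0 → Prop
  | 0, _ => True
  | k + 1, s => ∃ p ∈ D, ∃ q ∈ D, s < p ∧ p < q ∧ f p < a ∧ b < f q ∧ HasUpcrossings f a b D k q

section HasUpcrossings

variable {f : ℝ≥0 → ℝ} {a b : ℝ} {D D' : Set ℝ≥0}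

lemma HasUpcrossings.mono (hD : D ⊆ D') {k : ℕ} {s : ℝ≥0} (h : HasUpcrossings f a b D k s) :
    HasUpcrossings f a b D' k s := by
  induction k generalizing s with
  | zero => trivial
  | succ k ih =>
    obtain ⟨p, hp, q, hq, hsp, hpq, hfp, hfq, h⟩ := h
    exact ⟨p, hD hp, q, hD hq, hsp, hpq, hfp, hfq, ih h⟩

lemma HasUpcrossings.of_le {k : ℕ} {s s' : ℝ≥0} (h : HasUpcrossings f a b D k s) (hs : s' ≤ s) :
    HasUpcrossings f a b D k s' := by
  cases k with
  | zero => trivial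
  | succ k =>
    obtain ⟨p, hp, q, hq, hsp, h⟩ := h
    exact ⟨p, hp, q, hq, hs.trans_lt hsp, h⟩

lemma HasUpcrossings.exists_of_iUnion {D : ℕ → Set ℝ≥0} (hD : Monotone D) {k : ℕ} {s : ℝ≥0}
    (h : HasUpcrossings f a b (⋃ n, D n) k s) : ∃ n, HasUpcrossings f a b (D n) k s := by
  induction k generalizing s with
  | zero => exact ⟨0, trivial⟩
  | succ k ih =>
    obtain ⟨p, hp, q, hq, hsp, hpq, hfp, hfq, h⟩ := h
    obtain ⟨n₁, h₁⟩ := mem_iUnion.1 hp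
    obtain ⟨n₂, h₂⟩ := mem_iUnion.1 hq
    obtain ⟨n₃, h₃⟩ := ih h
    refine ⟨max n₁ (max n₂ n₃), p, hD (le_max_left _ _) h₁, q, hD ?_ h₂, hsp, hpq, hfp, hfq,
      h₃.mono (hD ?_)⟩ <;> simp

lemma hasUpcrossings_of_frequently_left {t : ℝ≥0} (ha : ∃ᶠ s in 𝓝[D ∩ Iio t] t, f s < a)
    (hb : ∃ᶠ s in 𝓝[D ∩ Iio t] t, b < f s) (k : ℕ) {s : ℝ≥0} (hs : s < t) :
    HasUpcrossings f a b D k s := by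
  induction k generalizing s with
  | zero => trivial
  | succ k ih =>
    have key {r : ℝ≥0} (hr : r < t) : ∀ᶠ u in 𝓝[D ∩ Iio t] t, u ∈ D ∧ u < t ∧ r < u := by
      filter_upwards [self_mem_nhdsWithin, mem_nhdsWithin_of_mem_nhds (Ioi_mem_nhds hr)]
        with u hu hru using ⟨hu.1, hu.2, hru⟩
    obtain ⟨p, hfp, hp, hpt, hsp⟩ := (ha.and_eventually (key hs)).exists
    obtain ⟨q, hfq, hq, hqt, hpq⟩ := (hb.and_eventually (key hpt)).exists
    exact ⟨p, hp, q, hq, hsp, hpq, hfp, hfq, ih hqt⟩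

lemma hasUpcrossings_of_frequently_right {t : ℝ≥0} (ha : ∃ᶠ s in 𝓝[D ∩ Ioi t] t, f s < a)
    (hb : ∃ᶠ s in 𝓝[D ∩ Ioi t] t, b < f s) (k : ℕ) : HasUpcrossings f a b D k t := by
  suffices ∃ s, t < s ∧ HasUpcrossings f a b D k s from
    let ⟨_, hts, h⟩ := this; h.of_le hts.le
  induction k with
  | zero => exact (exists_gt t).imp fun s hs => ⟨hs, trivial⟩
  | succ k ih =>
    obtain ⟨s, hts, h⟩ := ih
    have key {r : ℝ≥0} (hr : t < r) : ∀ᶠ u in 𝓝[D ∩ Ioi t] t, u ∈ D ∧ t < u ∧ u < r := by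
      filter_upwards [self_mem_nhdsWithin, mem_nhdsWithin_of_mem_nhds (Iio_mem_nhds hr)]
        with u hu hru using ⟨hu.1, hu.2, hru⟩
    obtain ⟨q, hfq, hq, htq, hqs⟩ := (hb.and_eventually (key hts)).exists
    obtain ⟨p, hfp, hp, htp, hpq⟩ := (ha.and_eventually (key htq)).exists
    obtain ⟨r, htr, hrp⟩ := exists_between htp
    exact ⟨r, htr, p, hp, q, hq, hrp, hpq, hfp, hfq, h.of_le hqs.le⟩

lemma hasOneSidedLimitsOn_of_not_hasUpcrossings {R : ℝ} (hR : ∀ s ∈ D, |f s| ≤ R)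
    (h : ∀ a b : ℚ, a < b → ∃ k, ¬ HasUpcrossings f a b D k 0) : HasOneSidedLimitsOn D f := by
  have hbdd (l : Filter ℝ≥0) (hl : ∀ᶠ s in l, s ∈ D) :
      l.IsBoundedUnder (· ≤ ·) f ∧ l.IsBoundedUnder (· ≥ ·) f :=
    ⟨isBoundedUnder_of_eventually_le (hl.mono fun s hs => (abs_le.1 (hR s hs)).2),
      isBoundedUnder_of_eventually_ge (hl.mono fun s hs => (abs_le.1 (hR s hs)).1)⟩
  have hdense : Dense (range ((↑) : ℚ → ℝ)) := Rat.denseRange_cast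
  refine fun t => ⟨?_, ?_⟩
  · have := hbdd (𝓝[D ∩ Iio t] t) (eventually_mem_nhdsWithin.mono fun s hs => hs.1)
    refine tendsto_of_no_upcrossings hdense ?_ this.1 this.2
    rintro _ ⟨a, rfl⟩ _ ⟨b, rfl⟩ hab ⟨ha, hb⟩
    obtain ⟨k, hk⟩ := h a b (mod_cast hab)
    obtain ⟨s, -, hs⟩ := (ha.and_eventually eventually_mem_nhdsWithin).exists
    exact hk (hasUpcrossings_of_frequently_left ha hb k (zero_le.trans_lt hs.2))
  · have := hbdd (𝓝[D ∩ Ioi t] t) (eventually_mem_nhdsWithin.mono fun s hs => hs.1)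
    refine tendsto_of_no_upcrossings hdense ?_ this.1 this.2
    rintro _ ⟨a, rfl⟩ _ ⟨b, rfl⟩ hab ⟨ha, hb⟩
    obtain ⟨k, hk⟩ := h a b (mod_cast hab)
    exact hk ((hasUpcrossings_of_frequently_right ha hb k).of_le zero_le)

lemma HasUpcrossings.exists_add_le_upcrossingsBefore {Ω : Type*} {f : ℝ≥0 → Ω → ℝ} {ω : Ω}
    (hab : a < b) {n k j : ℕ}
    (h : HasUpcrossings (fun t => f t ω) a b (range (dyadic n)) k (dyadic n j)) :
    ∃ N, upcrossingsBefore a b (fun i => f (dyadic n i)) j ω + k ≤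
      upcrossingsBefore a b (fun i => f (dyadic n i)) N ω := by
  suffices ∀ i ≤ j + 1, ∃ N, upcrossingsBefore a b (fun i => f (dyadic n i)) i ω + k ≤
      upcrossingsBefore a b (fun i => f (dyadic n i)) N ω from this j j.le_succ
  induction k generalizing j with
  | zero => exact fun i _ => ⟨i, le_rfl⟩
  | succ k ih =>
    intro i hi
    obtain ⟨_, ⟨p, rfl⟩, _, ⟨q, rfl⟩, hsp, hpq, hfp, hfq, h⟩ := h
    rw [(dyadic_strictMono n).lt_iff_lt] at hsp hpq
    obtain ⟨N, hN⟩ := ih h (q + 1) le_rfl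
    have := upcrossingsBefore_lt_of_exists_upcrossing (f := fun i => f (dyadic n i)) hab
      (hi.trans hsp) hfp hpq.le hfq
    exact ⟨N, by omega⟩

end HasUpcrossings

section Probability

variable {X : Type*} [NormedAddCommGroup X] [NormedSpace ℝ X] [CompleteSpace X]
  {Ω : Type*} {m0 : MeasurableSpace Ω} {μ : Measure Ω}

/-- The discrete-time filtration obtained by sampling `ℱ` at the dyadic numbers of level `n`. -/
noncomputable def dyadicFiltration (ℱ : Filtration ℝ≥0 m0) (n : ℕ) : Filtration ℕ m0 where
  seq i := ℱ (dyadic n i)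
  mono' _ _ hij := ℱ.mono ((dyadic_strictMono n).monotone hij)
  le' _ := ℱ.le _

lemma martingale_condExp_dyadic [IsFiniteMeasure μ] (ℱ : Filtration ℝ≥0 m0) (ξ : Ω → X) (n : ℕ) :
    Martingale (fun i => μ[ξ | ℱ (dyadic n i)]) (dyadicFiltration ℱ n) μ :=
  martingale_condExp ξ (dyadicFiltration ℱ n) μ

lemma MeasureTheory.Martingale.submartingale_norm {ι : Type*} [Preorder ι] {ℱ : Filtration ι m0}
    {f : ι → Ω → X} (hf : Martingale f ℱ μ) : Submartingale (fun i ω => ‖f i ω‖) ℱ μ := by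
  refine ⟨fun i => (hf.stronglyAdapted i).norm, fun i j hij => ?_, fun i => (hf.integrable i).norm⟩
  filter_upwards [hf.condExp_ae_eq hij, norm_condExp_le (μ := μ) (m := ℱ i) (f j)] with ω h₁ h₂
  rwa [h₁] at h₂

lemma ae_exists_not_hasUpcrossings [IsProbabilityMeasure μ] (ℱ : Filtration ℝ≥0 m0) {ξ : Ω → ℝ}
    {R : ℝ≥0} (hξ : ∀ᵐ ω ∂μ, |ξ ω| ≤ R) {a b : ℝ} (hab : a < b) :
    ∀ᵐ ω ∂μ, ∃ k, ¬ HasUpcrossings (fun t => (μ[ξ | ℱ t]) ω) a b dyadics k 0 := by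
  set f : ℝ≥0 → Ω → ℝ := fun t => μ[ξ | ℱ t]
  set C : ENNReal := ENNReal.ofReal (R + |a|) / ENNReal.ofReal (b - a)
  have hba : ENNReal.ofReal (b - a) ≠ 0 := by simpa using hab
  have hC : C ≠ ⊤ := (ENNReal.div_lt_top ENNReal.ofReal_ne_top hba).ne
  have hup (n : ℕ) : ∫⁻ ω, upcrossings a b (fun i => f (dyadic n i)) ω ∂μ ≤ C := by
    rw [ENNReal.le_div_iff_mul_le (.inl hba) (.inl ENNReal.ofReal_ne_top), mul_comm]
    refine ((martingale_condExp_dyadic ℱ ξ n).submartingale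
      |>.mul_lintegral_upcrossings_le_lintegral_pos_part a b).trans (iSup_le fun N => ?_)
    calc _ ≤ ∫⁻ _, ENNReal.ofReal (R + |a|) ∂μ := by
          refine lintegral_mono_ae ?_
          filter_upwards [ae_bdd_abs_condExp_of_ae_bdd_abs (m := ℱ (dyadic n N)) hξ] with ω hω
          refine ENNReal.ofReal_le_ofReal (sup_le ?_ (by positivity))
          linarith [(abs_le.1 hω).2, neg_abs_le a]
      _ = _ := by simp
  have hbound (k : ℕ) : k * μ {ω | HasUpcrossings (fun t => f t ω) a b dyadics k 0} ≤ C := by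
    have : {ω | HasUpcrossings (fun t => f t ω) a b dyadics k 0} ⊆
        ⋃ n, {ω | HasUpcrossings (fun t => f t ω) a b (range (dyadic n)) k 0} := fun ω hω =>
      mem_iUnion.2 (HasUpcrossings.exists_of_iUnion monotone_range_dyadic hω)
    grw [this]
    rw [Monotone.measure_iUnion fun n n' hn ω hω => hω.mono (monotone_range_dyadic hn),
      ENNReal.mul_iSup]
    refine iSup_le fun n => le_trans ?_ (hup n)
    refine le_trans ?_ (mul_meas_ge_le_lintegral₀ (((martingale_condExp_dyadic ℱ ξ
      n).stronglyAdapted.measurable_upcrossings hab).aemeasurable) k)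
    gcongr with ω
    intro hω
    rw [← dyadic_zero n] at hω
    obtain ⟨N, hN⟩ := hω.exists_add_le_upcrossingsBefore hab
    exact le_trans (by exact_mod_cast (Nat.le_add_left _ _).trans hN)
      (le_iSup (fun N => (upcrossingsBefore a b (fun i => f (dyadic n i)) N ω : ENNReal)) N)
  rw [ae_iff]
  push Not
  by_contra h0
  obtain ⟨k, hk⟩ := ENNReal.exists_nat_mul_gt h0 hC
  refine hk.not_ge (le_trans ?_ (hbound k))
  gcongr
  intro h
  exact h k

lemma ae_hasOneSidedLimitsOn_condExp_of_bounded [IsProbabilityMeasure μ] (ℱ : Filtration ℝ≥0 m0)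
    {ξ : Ω → ℝ} {R : ℝ≥0} (hξ : ∀ᵐ ω ∂μ, |ξ ω| ≤ R) :
    ∀ᵐ ω ∂μ, HasOneSidedLimitsOn dyadics (fun t => (μ[ξ | ℱ t]) ω) := by
  have h₁ : ∀ᵐ ω ∂μ, ∀ s ∈ dyadics, |(μ[ξ | ℱ s]) ω| ≤ R :=
    (ae_ball_iff countable_dyadics).2 fun s _ => ae_bdd_abs_condExp_of_ae_bdd_abs hξ
  have h₂ : ∀ᵐ ω ∂μ, ∀ a b : ℚ, a < b →
      ∃ k, ¬ HasUpcrossings (fun t => (μ[ξ | ℱ t]) ω) a b dyadics k 0 := by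
    simp_rw [ae_all_iff]
    exact fun a b hab => ae_exists_not_hasUpcrossings ℱ hξ (mod_cast hab)
  filter_upwards [h₁, h₂] with ω hω₁ hω₂ using hasOneSidedLimitsOn_of_not_hasUpcrossings hω₁ hω₂

/-- Doob's maximal inequality for the closed martingale `t ↦ μ[ξ | ℱ t]` over dyadic times. -/
lemma mul_measure_exists_lt_norm_condExp_le [IsProbabilityMeasure μ] (ℱ : Filtration ℝ≥0 m0)
    (ξ : Ω → X) (ε : ℝ≥0) :
    ε * μ {ω | ∃ s ∈ dyadics, ε < ‖(μ[ξ | ℱ s]) ω‖} ≤ ENNReal.ofReal (∫ ω, ‖ξ ω‖ ∂μ) := by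
  have hsub : {ω | ∃ s ∈ dyadics, ε < ‖(μ[ξ | ℱ s]) ω‖} ⊆
      ⋃ n, {ω | ∃ s ∈ range (dyadic n), ε < ‖(μ[ξ | ℱ s]) ω‖} := by
    rintro ω ⟨s, hs, h⟩
    obtain ⟨n, hn⟩ := mem_iUnion.1 hs
    exact mem_iUnion.2 ⟨n, s, hn, h⟩
  grw [hsub]
  have hmono : Monotone fun n => {ω | ∃ s ∈ range (dyadic n), ε < ‖(μ[ξ | ℱ s]) ω‖} :=
    fun n n' hn ω ⟨s, hs, h⟩ => ⟨s, monotone_range_dyadic hn hs, h⟩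
  rw [hmono.measure_iUnion, ENNReal.mul_iSup]
  refine iSup_le fun n => ?_
  set F : ℕ → Ω → ℝ := fun i ω => ‖(μ[ξ | ℱ (dyadic n i)]) ω‖
  have hF : Submartingale F (dyadicFiltration ℱ n) μ :=
    (martingale_condExp_dyadic ℱ ξ n).submartingale_norm
  have hsub : {ω | ∃ s ∈ range (dyadic n), ε < ‖(μ[ξ | ℱ s]) ω‖} ⊆
      ⋃ N, {ω | (ε : ℝ) ≤ (Finset.range (N + 1)).sup' Finset.nonempty_range_add_one
        fun k => F k ω} := by
    rintro ω ⟨_, ⟨i, rfl⟩, h⟩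
    exact mem_iUnion.2 ⟨i, h.le.trans
      (Finset.le_sup' (fun k => F k ω) (Finset.self_mem_range_succ i))⟩
  grw [hsub]
  rw [Monotone.measure_iUnion, ENNReal.mul_iSup]
  · refine iSup_le fun N => (maximal_ineq hF (fun _ _ => norm_nonneg _) N).trans ?_
    refine ENNReal.ofReal_le_ofReal (le_trans ?_
      (integral_norm_condExp_le (m := ℱ (dyadic n N)) ξ))
    exact setIntegral_le_integral (hF.integrable N) (ae_of_all _ fun _ => norm_nonneg _)
  · intro N N' hN ω hω
    rw [mem_ofPred_eq] at hω ⊢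
    exact hω.trans (Finset.sup'_mono _ (Finset.range_mono (Nat.succ_le_succ hN)) _)

/-- Almost every path of a closed martingale has one-sided limits along the dyadic numbers. -/
lemma ae_hasOneSidedLimitsOn_condExp [IsProbabilityMeasure μ] (ℱ : Filtration ℝ≥0 m0)
    {ξ : Ω → X} (hξ : Integrable ξ μ) :
    ∀ᵐ ω ∂μ, HasOneSidedLimitsOn dyadics (fun t => (μ[ξ | ℱ t]) ω) := by
  refine Integrable.induction
    (fun ξ : Ω → X => ∀ᵐ ω ∂μ, HasOneSidedLimitsOn dyadics fun t => (μ[ξ | ℱ t]) ω)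
    ?_ ?_ ?_ ?_ hξ
  · intro c s hs _
    have hbdd : ∀ᵐ ω ∂μ, |s.indicator (1 : Ω → ℝ) ω| ≤ (1 : ℝ≥0) := ae_of_all _ fun ω => by
      by_cases hω : ω ∈ s <;> simp [hω]
    have hcomp : ∀ᵐ ω ∂μ, ∀ t ∈ dyadics, (μ[s.indicator (1 : Ω → ℝ) | ℱ t]) ω • c =
        (μ[s.indicator fun _ => c | ℱ t]) ω := by
      refine (ae_ball_iff countable_dyadics).2 fun t _ => ?_
      have := (ContinuousLinearMap.toSpanSingleton ℝ c).comp_condExp_comm (m := ℱ t) (μ := μ)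
        (f := s.indicator (1 : Ω → ℝ)) ((integrable_const (1 : ℝ)).indicator hs)
      have h' : (ContinuousLinearMap.toSpanSingleton ℝ c) ∘ s.indicator (1 : Ω → ℝ) =
          s.indicator fun _ => c := by
        ext ω
        by_cases hω : ω ∈ s <;> simp [hω]
      rw [h'] at this
      filter_upwards [this] with ω hω
      simpa using hω
    filter_upwards [ae_hasOneSidedLimitsOn_condExp_of_bounded ℱ hbdd, hcomp] with ω h₁ h₂
    exact HasOneSidedLimitsOn.congr (fun t => ⟨(h₁ t).1.elim fun L hL => ⟨_, hL.smul_const c⟩,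
      (h₁ t).2.elim fun L hL => ⟨_, hL.smul_const c⟩⟩) h₂
  · intro f g _ hf hg ihf ihg
    have hadd : ∀ᵐ ω ∂μ, ∀ t ∈ dyadics, (μ[f | ℱ t]) ω + (μ[g | ℱ t]) ω = (μ[f + g | ℱ t]) ω :=
      (ae_ball_iff countable_dyadics).2 fun t _ => (condExp_add hf hg (ℱ t)).symm
    filter_upwards [ihf, ihg, hadd] with ω h₁ h₂ h
    refine HasOneSidedLimitsOn.congr (fun t => ⟨?_, ?_⟩) h
    · obtain ⟨L, hL⟩ := (h₁ t).1
      obtain ⟨L', hL'⟩ := (h₂ t).1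
      exact ⟨_, hL.add hL'⟩
    · obtain ⟨L, hL⟩ := (h₁ t).2
      obtain ⟨L', hL'⟩ := (h₂ t).2
      exact ⟨_, hL.add hL'⟩
  · refine isClosed_of_closure_subset fun ξ hξ => ?_
    have happrox (n : ℕ) : ∀ᵐ ω ∂μ, ∃ g : ℝ≥0 → X, HasOneSidedLimitsOn dyadics g ∧
        ∀ s ∈ dyadics, dist ((μ[ξ | ℱ s]) ω) (g s) ≤ 1 / ((n : ℝ) + 1) := by
      set ε : ℝ≥0 := 1 / ((n : ℝ≥0) + 1) with hε_def
      have hε : 0 < ε := by positivity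
      rw [ae_iff, ← nonpos_iff_eq_zero]
      refine ENNReal.le_of_forall_pos_le_add fun δ hδ _ => ?_
      obtain ⟨η, hη, hdist⟩ := Metric.mem_closure_iff.1 hξ (ε * δ : ℝ≥0) (by positivity)
      have hsub : ∀ᵐ ω ∂μ, ∀ s ∈ dyadics,
          (μ[⇑ξ - ⇑η | ℱ s]) ω = (μ[ξ | ℱ s]) ω - (μ[η | ℱ s]) ω :=
        (ae_ball_iff countable_dyadics).2 fun s _ =>
          condExp_sub (L1.integrable_coeFn ξ) (L1.integrable_coeFn η) (ℱ s)
      have hle : μ {ω | ¬ ∃ g : ℝ≥0 → X, HasOneSidedLimitsOn dyadics g ∧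
          ∀ s ∈ dyadics, dist ((μ[ξ | ℱ s]) ω) (g s) ≤ 1 / ((n : ℝ) + 1)} ≤
          μ {ω | ∃ s ∈ dyadics, ε < ‖(μ[⇑ξ - ⇑η | ℱ s]) ω‖} := by
        refine measure_mono_ae ?_
        filter_upwards [hη, hsub] with ω h₁ h₂ h₃
        by_contra hcon
        refine h₃ ⟨_, h₁, fun s hs => ?_⟩
        by_contra hlt
        refine hcon ⟨s, hs, ?_⟩
        rw [h₂ s hs, ← dist_eq_norm]
        simpa [hε_def] using hlt
      have hmax := mul_measure_exists_lt_norm_condExp_le (μ := μ) ℱ (⇑ξ - ⇑η) ε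
      have hint : ENNReal.ofReal (∫ ω, ‖(⇑ξ - ⇑η) ω‖ ∂μ) ≤ ε * δ := by
        have hnorm : (fun ω => ‖(ξ - η) ω‖) =ᵐ[μ] fun ω => ‖(⇑ξ - ⇑η) ω‖ :=
          (Lp.coeFn_sub ξ η).fun_comp norm
        rw [dist_eq_norm, L1.norm_eq_integral_norm, integral_congr_ae hnorm] at hdist
        rw [← ENNReal.coe_mul, ← ENNReal.ofReal_coe_nnreal]
        exact ENNReal.ofReal_le_ofReal hdist.le
      rw [zero_add]
      exact hle.trans ((ENNReal.mul_le_mul_iff_right (by simpa using hε.ne')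
        ENNReal.coe_ne_top).1 (hmax.trans hint))
    rw [← ae_all_iff] at happrox
    filter_upwards [happrox] with ω hω
    refine HasOneSidedLimitsOn.of_forall_dist_le fun ε hε => ?_
    obtain ⟨n, hn⟩ := exists_nat_one_div_lt hε
    obtain ⟨g, hg, h⟩ := hω n
    exact ⟨g, hg, fun s hs => (h s hs).trans hn.le⟩
  · intro f g hfg _ ih
    have hcongr : ∀ᵐ ω ∂μ, ∀ s ∈ dyadics, (μ[f | ℱ s]) ω = (μ[g | ℱ s]) ω :=
      (ae_ball_iff countable_dyadics).2 fun s _ => condExp_congr_ae hfg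
    filter_upwards [ih, hcongr] with ω h₁ h₂ using h₁.congr h₂

end Probability

lemma stronglyMeasurable_of_forall_gt {X : Type*} [TopologicalSpace X]
    [TopologicalSpace.PseudoMetrizableSpace X] {Ω : Type*} {m0 : MeasurableSpace Ω}
    {ℱ : Filtration ℝ≥0 m0} {t : ℝ≥0}
    (hright : (ℱ t : MeasurableSpace Ω) = ⨅ (s : ℝ≥0) (_ : t < s), ℱ s) {g : Ω → X}
    (hg : ∀ s, t < s → StronglyMeasurable[ℱ s] g) : StronglyMeasurable[ℱ t] g := by
  borelize X
  refine stronglyMeasurable_iff_measurable_separable.2 ⟨?_, ?_⟩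
  · intro A hA
    rw [hright]
    simp_rw [MeasurableSpace.measurableSet_iInf]
    exact fun s hs => (hg s hs).measurable hA
  · exact (hg (t + 1) (by simp)).isSeparable_range

section RightContinuity

variable {X : Type*} [NormedAddCommGroup X] [NormedSpace ℝ X] [CompleteSpace X]
  {Ω : Type*} {m0 : MeasurableSpace Ω} {μ : Measure Ω}

lemma unifIntegrable_condExp [IsFiniteMeasure μ] {ι : Type*} {ξ : Ω → X} (hξ : Integrable ξ μ)
    {m : ι → MeasurableSpace Ω} (hm : ∀ i, m i ≤ m0) :
    UnifIntegrable (fun i => μ[ξ | m i]) 1 μ := by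
  intro ε hε
  obtain ⟨δ, hδ, h⟩ := (hξ.norm.uniformIntegrable_condExp hm).unifIntegrable hε
  refine ⟨δ, hδ, fun i s hs hμs => le_trans (eLpNorm_mono_ae ?_) (h i s hs hμs)⟩
  filter_upwards [norm_condExp_le (μ := μ) (m := m i) ξ] with ω hω
  by_cases hωs : ω ∈ s
  · simpa [hωs] using hω.trans (le_abs_self _)
  · simp [hωs]

lemma MeasureTheory.Martingale.ae_eq_of_tendsto_right [IsProbabilityMeasure μ]
    {ℱ : Filtration ℝ≥0 m0} {t T : ℝ≥0}
    (hright : (ℱ t : MeasurableSpace Ω) = ⨅ (s : ℝ≥0) (_ : t < s), ℱ s)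
    (hnull : ∀ s : Set Ω, μ s = 0 → MeasurableSet[ℱ 0] s)
    {M : ℝ≥0 → Ω → X} (hM : Martingale M ℱ μ) {s : ℕ → ℝ≥0} (hts : ∀ n, t ≤ s n)
    (hsT : ∀ n, s n ≤ T) (hs : Tendsto s atTop (𝓝 t)) {L : Ω → X}
    (hL : ∀ᵐ ω ∂μ, Tendsto (fun n => M (s n) ω) atTop (𝓝 (L ω))) : L =ᵐ[μ] M t := by
  set C : Set Ω := {ω | Tendsto (fun n => M (s n) ω) atTop (𝓝 (L ω))}
  have hC (r : ℝ≥0) : MeasurableSet[ℱ r] C :=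
    (ℱ.mono zero_le _ (hnull Cᶜ hL)).of_compl
  have hLC : C.indicator L =ᵐ[μ] L := by
    filter_upwards [hL] with ω hω using indicator_of_mem hω L
  have hmeas : StronglyMeasurable[ℱ t] (C.indicator L) := by
    refine stronglyMeasurable_of_forall_gt hright fun r hr => ?_
    obtain ⟨n₀, hn₀⟩ := eventually_atTop.1 (hs.eventually_lt_const hr)
    refine stronglyMeasurable_of_tendsto atTop
      (f := fun n => C.indicator (M (s (n + n₀)))) (fun n => ?_) (tendsto_pi_nhds.2 fun ω => ?_)
    · exact ((hM.stronglyMeasurable _).mono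
        (ℱ.mono (hn₀ _ (Nat.le_add_left _ _)).le)).indicator (hC r)
    · by_cases hω : ω ∈ C
      · simpa [hω] using (tendsto_add_atTop_iff_nat n₀).2 hω
      · simp [hω]
  have hMT (n : ℕ) : μ[M T | ℱ (s n)] =ᵐ[μ] M (s n) := hM.condExp_ae_eq (hsT n)
  have hui : UnifIntegrable (fun n => M (s n)) 1 μ :=
    (unifIntegrable_condExp (hM.integrable T) fun n => ℱ.le (s n)).ae_eq hMT
  have hint : Integrable L μ := by
    refine memLp_one_iff_integrable.1 ⟨(hmeas.mono (ℱ.le t)).aestronglyMeasurable.congr hLC, ?_⟩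
    refine (Lp.eLpNorm_lim_le_liminf_eLpNorm
      (fun n => (hM.integrable (s n)).aestronglyMeasurable) L hL).trans_lt ?_
    refine lt_of_le_of_lt ?_ (memLp_one_iff_integrable.2 (hM.integrable T)).2
    refine (liminf_le_liminf (Eventually.of_forall fun n => ?_)).trans
      (liminf_const (f := atTop (α := ℕ)) (eLpNorm (M T) 1 μ)).le
    rw [← eLpNorm_congr_ae (hMT n)]
    exact eLpNorm_condExp_le_eLpNorm _ le_rfl
  have hL1 := tendsto_Lp_finite_of_tendsto_ae le_rfl ENNReal.one_ne_top
    (fun n => (hM.integrable (s n)).aestronglyMeasurable) (memLp_one_iff_integrable.2 hint) hui hL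
  have hcond : μ[L | ℱ t] =ᵐ[μ] L := (condExp_congr_ae hLC.symm).trans <| by
    rw [condExp_of_stronglyMeasurable (ℱ.le t) hmeas (hint.congr hLC.symm)]
    exact hLC
  have hle (n : ℕ) : eLpNorm (M t - L) 1 μ ≤ eLpNorm (M (s n) - L) 1 μ := by
    refine le_trans (eLpNorm_congr_ae ?_).le
      (eLpNorm_condExp_le_eLpNorm (m := ℱ t) (M (s n) - L) le_rfl)
    exact ((condExp_sub (hM.integrable _) hint _).trans
      ((hM.condExp_ae_eq (hts n)).sub hcond)).symm
  have hzero : eLpNorm (M t - L) 1 μ = 0 := nonpos_iff_eq_zero.1 (ge_of_tendsto' hL1 hle)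
  rw [eLpNorm_eq_zero_iff ((hM.integrable t).sub hint).aestronglyMeasurable one_ne_zero] at hzero
  filter_upwards [hzero] with ω hω using (sub_eq_zero.1 hω).symm

/-- Almost every path of a martingale has one-sided limits along the dyadic numbers. -/
lemma MeasureTheory.Martingale.ae_hasOneSidedLimitsOn [IsProbabilityMeasure μ]
    {ℱ : Filtration ℝ≥0 m0} {M : ℝ≥0 → Ω → X} (hM : Martingale M ℱ μ) :
    ∀ᵐ ω ∂μ, HasOneSidedLimitsOn dyadics fun t => M t ω := by
  have h₁ : ∀ᵐ ω ∂μ, ∀ T : ℕ, HasOneSidedLimitsOn dyadics fun t => (μ[M T | ℱ t]) ω :=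
    ae_all_iff.2 fun T => ae_hasOneSidedLimitsOn_condExp ℱ (hM.integrable T)
  have h₂ : ∀ᵐ ω ∂μ, ∀ T : ℕ, ∀ s ∈ dyadics, s ≤ T → (μ[M T | ℱ s]) ω = M s ω := by
    refine ae_all_iff.2 fun T => (ae_ball_iff countable_dyadics).2 fun s _ => ?_
    by_cases hsT : s ≤ T
    · filter_upwards [hM.condExp_ae_eq hsT] with ω hω _ using hω
    · exact ae_of_all _ fun ω h => absurd h hsT
  filter_upwards [h₁, h₂] with ω hω₁ hω₂ t
  obtain ⟨T, hT⟩ := exists_nat_gt t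
  have heq (V : Set ℝ≥0) : ∀ᶠ s in 𝓝[dyadics ∩ V] t, (μ[M T | ℱ s]) ω = M s ω := by
    filter_upwards [self_mem_nhdsWithin, mem_nhdsWithin_of_mem_nhds (Iio_mem_nhds hT)]
      with s hs hsT using hω₂ T s hs.1 (le_of_lt hsT)
  exact ⟨(hω₁ T t).1.imp fun L hL => hL.congr' (heq _),
    (hω₁ T t).2.imp fun L hL => hL.congr' (heq _)⟩

end RightContinuity

/-- Let `X` be a Banach space and let `(Ω, F, P)` be a probability space with a filtration
`ℱ = (ℱ_t)_{t ≥ 0}` satisfying the usual conditions (right-continuity, and `ℱ_0` contains all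
`P`-null sets). Then every `X`-valued martingale `M` admits a càdlàg version: a process `N`
with `N_t = M_t` a.s. for every `t`, almost all of whose paths are right-continuous with left
limits. -/
theorem martingale_exists_cadlag_version
    {X : Type*} [NormedAddCommGroup X] [NormedSpace ℝ X] [CompleteSpace X]
    {Ω : Type*} {m0 : MeasurableSpace Ω} {μ : Measure Ω} [IsProbabilityMeasure μ]
    (ℱ : Filtration ℝ≥0 m0)
    (hright : ∀ t : ℝ≥0, (ℱ t : MeasurableSpace Ω) = ⨅ (s : ℝ≥0) (_ : t < s), ℱ s)
    (hnull : ∀ s : Set Ω, μ s = 0 → MeasurableSet[ℱ 0] s)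
    (M : ℝ≥0 → Ω → X) (hM : Martingale M ℱ μ) :
    ∃ N : ℝ≥0 → Ω → X,
      (∀ t : ℝ≥0, N t =ᵐ[μ] M t) ∧
      (∀ᵐ ω ∂μ,
        (∀ t : ℝ≥0, ContinuousWithinAt (fun s => N s ω) (Set.Ici t) t) ∧
        (∀ t : ℝ≥0, 0 < t → ∃ L : X, Tendsto (fun s => N s ω) (𝓝[<] t) (𝓝 L))) := by
  have hlim := hM.ae_hasOneSidedLimitsOn
  refine ⟨fun t ω => rightLimPath (fun s => M s ω) t, fun t => ?_, ?_⟩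
  · refine hM.ae_eq_of_tendsto_right (hright t) hnull (T := t + 1)
      (fun n => (lt_dyadicAbove t n).le) (fun n => (dyadicAbove_le t n).trans ?_)
      (tendsto_dyadicAbove t) ?_
    · gcongr
      exact pow_le_one₀ zero_le (inv_le_one_of_one_le₀ one_le_two)
    · filter_upwards [hlim] with ω hω
      exact (hω.tendsto_rightLimPath t).comp (tendsto_dyadicAbove_nhdsWithin t)
  · filter_upwards [hlim] with ω hω
    exact ⟨hω.continuousWithinAt_rightLimPath,
      fun t _ => hω.exists_tendsto_rightLimPath_left t⟩
end

section
/- Let X be a Banach space over the scalar field 𝕂 (either ℝ or ℂ), let (S, Σ, μ) be a measure space, and let f, g : S → X be strongly measurable functions such that for every x* ∈ X* one has |⟨g(s), x*⟩| ≤ |⟨f(s), x*⟩| for μ-almost every s ∈ S. Then there exists a measurable function a : S → 𝕂 with |a(s)| ≤ 1 for all s ∈ S such that g = a·f μ-almost everywhere. -/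
open MeasureTheory

/-- A separable set in a normed space admits a sequence of continuous functionals that vanishes
simultaneously at no nonzero point of the set. -/
theorem TopologicalSpace.IsSeparable.exists_seq_dual_separating (𝕜 : Type*) [RCLike 𝕜]
    {X : Type*} [NormedAddCommGroup X] [NormedSpace 𝕜 X] {t : Set X}
    (ht : TopologicalSpace.IsSeparable t) :
    ∃ L : ℕ → X →L[𝕜] 𝕜, ∀ x ∈ t, (∀ n, L n x = 0) → x = 0 := by
  obtain ⟨c, hc, htc⟩ := ht
  obtain ⟨d, hd⟩ := (hc.insert 0).exists_eq_range (Set.insert_nonempty 0 c)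
  choose L hL_norm hL using fun n ↦ exists_dual_vector'' 𝕜 (d n)
  refine ⟨L, fun x hx hLx ↦ ?_⟩
  by_contra hne
  have hx_closure : x ∈ closure (Set.range d) :=
    hd ▸ closure_mono (Set.subset_insert 0 c) (htc hx)
  obtain ⟨_, ⟨n, rfl⟩, hn⟩ := Metric.mem_closure_iff.1 hx_closure (‖x‖ / 2)
    (half_pos (norm_pos_iff.2 hne))
  rw [dist_eq_norm] at hn
  have hdn : ‖d n‖ ≤ ‖x - d n‖ := calc
    ‖d n‖ = ‖L n (x - d n)‖ := by simp [hLx n, hL n]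
    _ ≤ 1 * ‖x - d n‖ := (L n).le_of_opNorm_le (hL_norm n) _
    _ = ‖x - d n‖ := one_mul _
  have hx_le : ‖x‖ ≤ ‖x - d n‖ + ‖d n‖ := by
    simpa using norm_add_le (x - d n) (d n)
  linarith

/-- If a sequence of functionals separates the points of a subspace `V` and the combinations
`L n + q • L m`, with `q` in a dense set, are dominated at `y` by their values at `x`, then `y` is
the multiple of `x` determined by any functional `L k` with `L k x ≠ 0`. -/
theorem eq_div_smul_of_dominated {𝕜 X : Type*} [RCLike 𝕜] [NormedAddCommGroup X]
    [NormedSpace 𝕜 X] {V : Submodule 𝕜 X} {L : ℕ → X →L[𝕜] 𝕜}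
    (hL : ∀ z ∈ V, (∀ n, L n z = 0) → z = 0) {ι : Type*} {q : ι → 𝕜} (hq : DenseRange q)
    {x y : X} (hx : x ∈ V) (hy : y ∈ V)
    (h : ∀ n m i, ‖(L n + q i • L m) y‖ ≤ ‖(L n + q i • L m) x‖) {k : ℕ} (hk : L k x ≠ 0) :
    y = (L k y / L k x) • x := by
  have h_all (n m : ℕ) (c : 𝕜) : ‖(L n + c • L m) y‖ ≤ ‖(L n + c • L m) x‖ := by
    refine hq.induction_on (p := fun c ↦ ‖(L n + c • L m) y‖ ≤ ‖(L n + c • L m) x‖) c ?_ (h n m)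
    simp only [add_apply, smul_apply, smul_eq_mul]
    exact isClosed_le (by fun_prop) (by fun_prop)
  refine sub_eq_zero.1 (hL _ (V.sub_mem hy (V.smul_mem _ hx)) fun n ↦ ?_)
  have hn := h_all n k (-(L n x / L k x))
  have hx_zero : (L n + (-(L n x / L k x)) • L k) x = 0 := by
    simp [hk]
  rw [hx_zero, norm_zero, norm_le_zero_iff] at hn
  simp only [add_apply, smul_apply, smul_eq_mul] at hn
  simp only [map_sub, map_smul, smul_eq_mul]
  linear_combination hn

/-- Two sequences of measurable scalar functions admit a measurable selection of the quotient
`v n / u n` at an index with `u n ≠ 0`, wherever there is such an index. -/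
theorem exists_measurable_eq_div {𝕜 S : Type*} [RCLike 𝕜] [MeasurableSpace S]
    {u v : ℕ → S → 𝕜} (hu : ∀ n, Measurable (u n)) (hv : ∀ n, Measurable (v n)) :
    ∃ a : S → 𝕜, Measurable a ∧
      ∀ s, (∃ n, u n s ≠ 0) → ∃ n, u n s ≠ 0 ∧ a s = v n s / u n s := by
  classical
  have h_exists (s : S) : ∃ n, u n s ≠ 0 ∨ ∀ m, u m s = 0 := by
    by_cases hs : ∃ n, u n s ≠ 0
    · exact hs.imp fun n hn ↦ Or.inl hn
    · exact ⟨0, Or.inr (by simpa using hs)⟩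
  have h_meas (n : ℕ) : MeasurableSet {s | u n s ≠ 0 ∨ ∀ m, u m s = 0} := by
    have h_zero (m : ℕ) : MeasurableSet {s | u m s = 0} := hu m (measurableSet_singleton 0)
    have h_forall : MeasurableSet {s | ∀ m, u m s = 0} := by
      rw [Set.ofPred_forall]
      exact MeasurableSet.iInter h_zero
    exact (h_zero n).compl.union h_forall
  refine ⟨_, Measurable.find (fun n ↦ (hv n).div (hu n)) h_meas h_exists, ?_⟩
  rintro s ⟨m, hm⟩
  exact ⟨_, (Nat.find_spec (h_exists s)).resolve_right fun h ↦ hm (h m), rfl⟩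

/-- Let `X` be a Banach space over `𝕜 ∈ {ℝ, ℂ}`, `(S, Σ, μ)` a measure space, and
`f, g : S → X` strongly measurable functions (pointwise a.e. limits of simple functions) such
that for every continuous linear functional `L ∈ X*` one has `‖L (g s)‖ ≤ ‖L (f s)‖` for
μ-a.e. `s`. Then there is a measurable scalar function `a` with `‖a‖ ≤ 1` everywhere and
`g = a • f` μ-almost everywhere. -/
theorem exists_scalar_factor_of_weak_domination
    {𝕜 : Type*} [RCLike 𝕜] {X : Type*} [NormedAddCommGroup X] [NormedSpace 𝕜 X]
    [CompleteSpace X]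
    {S : Type*} [MeasurableSpace S] (μ : Measure S)
    (f g : S → X) (hf : AEStronglyMeasurable f μ) (hg : AEStronglyMeasurable g μ)
    (h : ∀ L : X →L[𝕜] 𝕜, ∀ᵐ s ∂μ, ‖L (g s)‖ ≤ ‖L (f s)‖) :
    ∃ a : S → 𝕜, Measurable a ∧ (∀ s, ‖a s‖ ≤ 1) ∧ ∀ᵐ s ∂μ, g s = a s • f s := by
  obtain ⟨f', hf', hff'⟩ := hf
  obtain ⟨g', hg', hgg'⟩ := hg
  let V := Submodule.span 𝕜 (Set.range f' ∪ Set.range g')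
  have hfV (s : S) : f' s ∈ V := Submodule.subset_span (Or.inl ⟨s, rfl⟩)
  have hgV (s : S) : g' s ∈ V := Submodule.subset_span (Or.inr ⟨s, rfl⟩)
  have hV : TopologicalSpace.IsSeparable (V : Set X) :=
    (hf'.isSeparable_range.union hg'.isSeparable_range).span
  obtain ⟨L, hL⟩ := hV.exists_seq_dual_separating 𝕜
  have hLf (n : ℕ) : Measurable fun s ↦ L n (f' s) :=
    ((L n).continuous.comp_stronglyMeasurable hf').measurable
  have hLg (n : ℕ) : Measurable fun s ↦ L n (g' s) :=
    ((L n).continuous.comp_stronglyMeasurable hg').measurable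
  obtain ⟨b, hb, hb_eq⟩ := exists_measurable_eq_div hLf hLg
  classical
  have h_dom : ∀ᵐ s ∂μ, ∀ n m i,
      ‖(L n + TopologicalSpace.denseSeq 𝕜 i • L m) (g s)‖ ≤
        ‖(L n + TopologicalSpace.denseSeq 𝕜 i • L m) (f s)‖ := by
    simp only [ae_all_iff]
    exact fun n m i ↦ h _
  have h_dom_L : ∀ᵐ s ∂μ, ∀ n, ‖L n (g s)‖ ≤ ‖L n (f s)‖ := ae_all_iff.2 fun n ↦ h (L n)
  refine ⟨fun s ↦ if ‖b s‖ ≤ 1 then b s else 0,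
    Measurable.ite (measurableSet_le hb.norm measurable_const) hb measurable_const,
    fun s ↦ ?_, ?_⟩
  · dsimp only
    split_ifs with hs
    · exact hs
    · simp
  · filter_upwards [hff', hgg', h_dom, h_dom_L] with s hfs hgs hs hs_L
    rw [hfs, hgs] at *
    by_cases hf_ne : ∃ n, L n (f' s) ≠ 0
    · obtain ⟨n, hn, hbn⟩ := hb_eq s hf_ne
      have hb_le : ‖b s‖ ≤ 1 := by
        rw [hbn, norm_div]
        exact div_le_one_of_le₀ (hs_L n) (norm_nonneg _)
      rw [if_pos hb_le, hbn]
      exact eq_div_smul_of_dominated hL (TopologicalSpace.denseRange_denseSeq 𝕜) (hfV s) (hgV s)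
        hs hn
    · push Not at hf_ne
      have hg_zero : g' s = 0 :=
        hL _ (hgV s) fun n ↦ norm_le_zero_iff.1 (by simpa [hf_ne n] using hs_L n)
      rw [hg_zero, hL _ (hfV s) hf_ne, smul_zero]
end

section
/- Let X be a Banach space over the scalar field 𝕂 (either ℝ or ℂ), and let (f_n)_{n≥0} and (g_n)_{n≥0} be X-valued martingales on a probability space (Ω, F, P) with filtration (F_n)_{n≥0}. Then g is weakly differentially subordinated to f if and only if there exists an adapted scalar-valued process (a_n)_{n≥0} such that |a_n| ≤ 1 almost surely for all n ≥ 0, dg_n = a_n · df_n almost surely for all n ≥ 1, and g_0 = a_0 · f_0 almost surely. -/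
open MeasureTheory

/-- Weak differential subordination of `g` to `f`: for every continuous linear functional
`L ∈ X*`, `‖L g_0‖ ≤ ‖L f_0‖` a.s. and `‖L (dg_n)‖ ≤ ‖L (df_n)‖` a.s. for every `n ≥ 1`. -/
def WeaklyDiffSubord (𝕜 : Type*) [RCLike 𝕜] {X : Type*} [NormedAddCommGroup X]
    [NormedSpace 𝕜 X] {Ω : Type*} {m0 : MeasurableSpace Ω} (μ : Measure Ω)
    (f g : ℕ → Ω → X) : Prop :=
  ∀ L : X →L[𝕜] 𝕜,
    (∀ᵐ ω ∂μ, ‖L (g 0 ω)‖ ≤ ‖L (f 0 ω)‖) ∧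
    ∀ n : ℕ, ∀ᵐ ω ∂μ, ‖L (g (n + 1) ω - g n ω)‖ ≤ ‖L (f (n + 1) ω - f n ω)‖

open TopologicalSpace

/-- An open cover can be replaced by a countable subfamily on the range of a map with separable
range. -/
theorem TopologicalSpace.IsSeparable.exists_countable_forall_range_mem {Ω E ι : Type*}
    [PseudoMetricSpace E] {w : Ω → E} (hw : IsSeparable (Set.range w)) {U : ι → Set E}
    (hU : ∀ i, IsOpen (U i)) :
    ∃ t : Set ι, t.Countable ∧ ∀ ω i, w ω ∈ U i → ∃ j ∈ t, w ω ∈ U j := by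
  have := hw.secondCountableTopology
  obtain ⟨t, ht, h⟩ := eq_open_union_countable
    (fun i ↦ ((↑) : Set.range w → E) ⁻¹' U i) fun i ↦ (hU i).preimage continuous_subtype_val
  refine ⟨t, ht, fun ω i hi ↦ ?_⟩
  have hmem : (⟨w ω, ω, rfl⟩ : Set.range w) ∈ ⋃ i, ((↑) : Set.range w → E) ⁻¹' U i :=
    Set.mem_iUnion.2 ⟨i, hi⟩
  rw [← h] at hmem
  simpa using hmem

section

variable {𝕜 X Ω : Type*} [RCLike 𝕜] [NormedAddCommGroup X] [NormedSpace 𝕜 X]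

/-- If `x` dominates `y` under every functional, then any functional not vanishing at `x`
recovers the scalar factor between `x` and `y`. -/
theorem eq_div_smul_of_forall_norm_le {x y : X} (h : ∀ L : X →L[𝕜] 𝕜, ‖L y‖ ≤ ‖L x‖)
    {L : X →L[𝕜] 𝕜} (hL : L x ≠ 0) : y = (L y / L x) • x := by
  rw [← sub_eq_zero]
  refine SeparatingDual.eq_zero_of_forall_dual_eq_zero (R := 𝕜) fun M ↦ ?_
  have hM := h (M - (M x / L x) • L)
  have hx : (M - (M x / L x) • L) x = 0 := by simp [hL]
  rw [hx, norm_zero, norm_le_zero_iff] at hM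
  simp only [sub_apply, smul_apply, smul_eq_mul,
    map_sub, map_smul] at hM ⊢
  rw [← hM]
  ring

/-- Almost sure domination under each functional holds simultaneously for all functionals. -/
theorem MeasureTheory.StronglyMeasurable.ae_forall_dual_norm_le {m m0 : MeasurableSpace Ω}
    {μ : Measure[m0] Ω} {u v : Ω → X} (hu : StronglyMeasurable[m] u)
    (hv : StronglyMeasurable[m] v) (h : ∀ L : X →L[𝕜] 𝕜, ∀ᵐ ω ∂μ, ‖L (v ω)‖ ≤ ‖L (u ω)‖) :
    ∀ᵐ ω ∂μ, ∀ L : X →L[𝕜] 𝕜, ‖L (v ω)‖ ≤ ‖L (u ω)‖ := by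
  obtain ⟨t, ht, hcover⟩ := (hu.prodMk hv).isSeparable_range.exists_countable_forall_range_mem
    (U := fun L : X →L[𝕜] 𝕜 ↦ {p : X × X | ‖L p.1‖ < ‖L p.2‖})
    fun L ↦ isOpen_lt (by fun_prop) (by fun_prop)
  filter_upwards [(ae_ball_iff ht).2 fun L _ ↦ h L] with ω hω L
  by_contra! hlt
  obtain ⟨M, hMt, hM⟩ := hcover ω L hlt
  exact (hω M hMt).not_gt hM

/-- A strongly measurable function admits a countable family of functionals which jointly detect
its zeros. -/
theorem MeasureTheory.StronglyMeasurable.exists_seq_dual_ne_zero {m : MeasurableSpace Ω}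
    {u : Ω → X} (hu : StronglyMeasurable u) :
    ∃ L : ℕ → X →L[𝕜] 𝕜, ∀ ω, (∀ k, L k (u ω) = 0) → u ω = 0 := by
  obtain ⟨t, ht, hcover⟩ := hu.isSeparable_range.exists_countable_forall_range_mem
    (U := fun L : X →L[𝕜] 𝕜 ↦ {x : X | L x ≠ 0})
    fun L ↦ isOpen_ne_fun (by fun_prop) (by fun_prop)
  obtain ⟨L, hL⟩ := (ht.insert 0).exists_eq_range (Set.insert_nonempty 0 t)
  refine ⟨L, fun ω hω ↦ SeparatingDual.eq_zero_of_forall_dual_eq_zero (R := 𝕜) fun M ↦ ?_⟩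
  by_contra hM
  obtain ⟨N, hNt, hN⟩ := hcover ω M hM
  obtain ⟨k, rfl⟩ : N ∈ Set.range L := hL ▸ Set.mem_insert_of_mem 0 hNt
  exact hN (hω k)

/-- Weak almost sure domination between strongly measurable functions yields a measurable scalar
factor. -/
theorem MeasureTheory.StronglyMeasurable.exists_measurable_factor {m m0 : MeasurableSpace Ω}
    {μ : Measure[m0] Ω} {u v : Ω → X} (hu : StronglyMeasurable[m] u)
    (hv : StronglyMeasurable[m] v) (h : ∀ L : X →L[𝕜] 𝕜, ∀ᵐ ω ∂μ, ‖L (v ω)‖ ≤ ‖L (u ω)‖) :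
    ∃ a : Ω → 𝕜, Measurable[m] a ∧ (∀ᵐ ω ∂μ, ‖a ω‖ ≤ 1) ∧ ∀ᵐ ω ∂μ, v ω = a ω • u ω := by
  classical
  obtain ⟨L, hL⟩ := hu.exists_seq_dual_ne_zero (𝕜 := 𝕜)
  have hmeas (w : Ω → X) (hw : StronglyMeasurable[m] w) (k : ℕ) :
      Measurable[m] fun ω ↦ L k (w ω) :=
    ((L k).continuous.comp_stronglyMeasurable hw).measurable
  have hzero (k : ℕ) : MeasurableSet[m] {ω | L k (u ω) = 0} :=
    hmeas u hu k (measurableSet_singleton 0)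
  let p (k : ℕ) (ω : Ω) : Prop := L k (u ω) ≠ 0 ∨ ∀ j, L j (u ω) = 0
  have hp (ω : Ω) : ∃ k, p k ω := by
    by_cases hω : ∀ j, L j (u ω) = 0
    · exact ⟨0, .inr hω⟩
    · push Not at hω
      exact hω.imp fun _ ↦ .inl
  have hpm (k : ℕ) : MeasurableSet[m] {ω | p k ω} := by
    have hall : MeasurableSet[m] {ω | ∀ j, L j (u ω) = 0} := by
      rw [Set.ofPred_forall]
      exact .iInter hzero
    exact (hzero k).compl.union hall
  have hbound := hu.ae_forall_dual_norm_le hv h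
  refine ⟨fun ω ↦ L (Nat.find (hp ω)) (v ω) / L (Nat.find (hp ω)) (u ω),
    Measurable.find (f := fun k ω ↦ L k (v ω) / L k (u ω))
      (fun k ↦ (hmeas v hv k).div (hmeas u hu k)) hpm hp, ?_, ?_⟩
  · filter_upwards [hbound] with ω hω
    rw [norm_div]
    exact div_le_one_of_le₀ (hω _) (norm_nonneg _)
  · filter_upwards [hbound] with ω hω
    rcases Nat.find_spec (hp ω) with hne | hall
    · exact eq_div_smul_of_forall_norm_le hω hne
    · have hu0 := hL ω hall
      have hv0 : v ω = 0 := by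
        refine SeparatingDual.eq_zero_of_forall_dual_eq_zero (R := 𝕜) fun M ↦ ?_
        simpa [hu0] using hω M
      simp [hu0, hv0]

end

/-- `g` is weakly differentially subordinated to `f` if and only if there is an adapted scalar
process `(a_n)` with `|a_n| ≤ 1` a.s. such that `g_0 = a_0 f_0` a.s. and `dg_n = a_n df_n`
a.s. for all `n ≥ 1`. -/
theorem weaklyDiffSubord_iff_exists_adapted_factor
    {𝕜 : Type*} [RCLike 𝕜] {X : Type*} [NormedAddCommGroup X] [NormedSpace 𝕜 X]
    [NormedSpace ℝ X] [IsScalarTower ℝ 𝕜 X] [CompleteSpace X]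
    {Ω : Type*} {m0 : MeasurableSpace Ω} {μ : Measure Ω} [IsProbabilityMeasure μ]
    {ℱ : Filtration ℕ m0} (f g : ℕ → Ω → X)
    (hf : Martingale f ℱ μ) (hg : Martingale g ℱ μ) :
    WeaklyDiffSubord 𝕜 μ f g ↔
      ∃ a : ℕ → Ω → 𝕜, Adapted ℱ a ∧ (∀ n, ∀ᵐ ω ∂μ, ‖a n ω‖ ≤ 1) ∧
        (∀ᵐ ω ∂μ, g 0 ω = a 0 ω • f 0 ω) ∧
        ∀ n : ℕ, ∀ᵐ ω ∂μ, g (n + 1) ω - g n ω = a (n + 1) ω • (f (n + 1) ω - f n ω) := by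
  constructor
  · intro h
    obtain ⟨a₀, ha₀, hle₀, heq₀⟩ := (hf.1 0).exists_measurable_factor (hg.1 0) fun L ↦ (h L).1
    have hstep (n : ℕ) := StronglyMeasurable.exists_measurable_factor (μ := μ)
      ((hf.1 (n + 1)).sub ((hf.1 n).mono (ℱ.mono n.le_succ)))
      ((hg.1 (n + 1)).sub ((hg.1 n).mono (ℱ.mono n.le_succ))) fun L ↦ (h L).2 n
    choose a ha hle heq using hstep
    refine ⟨fun n ↦ n.casesOn a₀ a, ?_, ?_, heq₀, heq⟩
    · rintro (_ | n)
      exacts [ha₀, ha n]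
    · rintro (_ | n)
      exacts [hle₀, hle n]
  · rintro ⟨a, -, hle, heq₀, heq⟩ L
    refine ⟨?_, fun n ↦ ?_⟩
    · filter_upwards [hle 0, heq₀] with ω hω hω'
      rw [hω', map_smul, norm_smul]
      exact mul_le_of_le_one_left (norm_nonneg _) hω
    · filter_upwards [hle (n + 1), heq n] with ω hω hω'
      rw [hω', map_smul, norm_smul]
      exact mul_le_of_le_one_left (norm_nonneg _) hω
end

section
/- Let X be a Banach space over the scalar field 𝕂 (either ℝ or ℂ), p ∈ (1,∞), and let U : X × X → ℝ be a zigzag-concave function (meaning: for every x, y ∈ X and every scalar ε with |ε| ≤ 1, the function z ↦ U(x+z, y+εz) is concave on X) satisfying the homogeneity U(αx, αy) = |α|^p U(x,y) for all scalars α ∈ 𝕂 and all x, y ∈ X. Then for every x ∈ X and every scalar ε with |ε| ≤ 1, one has U(x, εx) ≤ 0. -/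
/-- `U : X × X → ℝ` is zigzag-concave: for all `x, y ∈ X` and every scalar `ε` with `|ε| ≤ 1`,
the map `z ↦ U (x + z) (y + ε z)` is concave on `X`. -/
def ZigzagConcave (𝕜 : Type*) [RCLike 𝕜] {X : Type*} [NormedAddCommGroup X]
    [NormedSpace 𝕜 X] [NormedSpace ℝ X] (U : X → X → ℝ) : Prop :=
  ∀ (x y : X) (ε : 𝕜), ‖ε‖ ≤ 1 →
    ConcaveOn ℝ Set.univ (fun z : X => U (x + z) (y + ε • z))

/-- If `U` is zigzag-concave and `p`-homogeneous, i.e. `U(αx, αy) = |α|^p U(x,y)` for all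
scalars `α`, then `U(x, εx) ≤ 0` for every `x ∈ X` and every scalar `ε` with `|ε| ≤ 1`. -/
theorem zigzagConcave_nonpos_on_diagonal
    {𝕜 : Type*} [RCLike 𝕜] {X : Type*} [NormedAddCommGroup X] [NormedSpace 𝕜 X]
    [NormedSpace ℝ X] [IsScalarTower ℝ 𝕜 X] [CompleteSpace X]
    (p : ℝ) (hp : 1 < p) (U : X → X → ℝ) (hU : ZigzagConcave 𝕜 U)
    (hhom : ∀ (α : 𝕜) (x y : X), U (α • x) (α • y) = ‖α‖ ^ p * U x y)
    (x : X) (ε : 𝕜) (hε : ‖ε‖ ≤ 1) :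
    U x (ε • x) ≤ 0 := by
  have hconc := hU 0 0 ε hε
  have hzero : U 0 0 = 0 := by
    simpa [Real.zero_rpow (by linarith : p ≠ 0)] using hhom 0 0 0
  have heven : U (-x) (-(ε • x)) = U x (ε • x) := by
    simpa using hhom (-1) x (ε • x)
  have hmid := hconc.2 (Set.mem_univ x) (Set.mem_univ (-x))
    (by norm_num : (0 : ℝ) ≤ 1 / 2) (by norm_num : (0 : ℝ) ≤ 1 / 2) (by norm_num)
  simp only [zero_add, smul_neg, add_neg_cancel, smul_zero, hzero, heven, smul_eq_mul] at hmid
  linarith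
end

section
/- Let X be a Banach space over the scalar field 𝕂 (either ℝ or ℂ), and let U : X × X → ℝ be a zigzag-concave function (meaning: for every x, y ∈ X and every scalar ε with |ε| ≤ 1, the function z ↦ U(x+z, y+εz) is concave on X). Define V : X × X → ℝ by V(x,y) = U((x−y)/2, (x+y)/2). Then for all x, y ∈ X and all scalars a, b ∈ 𝕂 with |a+b| ≤ |a−b|, the function z ↦ V(x+az, y+bz) is concave on X; in particular V is biconcave, i.e., for every fixed x, y ∈ X the maps z ↦ V(x+z, y) and z ↦ V(x, y+z) are concave on X. -/
/-- If `U` is zigzag-concave and `V(x,y) := U((x-y)/2, (x+y)/2)`, then for all scalars `a, b`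
with `|a + b| ≤ |a - b|` the map `z ↦ V(x + a z, y + b z)` is concave; in particular `V` is
biconcave. -/
theorem biconcave_of_zigzagConcave
    {𝕜 : Type*} [RCLike 𝕜] {X : Type*} [NormedAddCommGroup X] [NormedSpace 𝕜 X]
    [NormedSpace ℝ X] [IsScalarTower ℝ 𝕜 X]
    (U : X → X → ℝ) (hU : ZigzagConcave 𝕜 U)
    (V : X → X → ℝ)
    (hV : ∀ x y : X, V x y = U ((2 : ℝ)⁻¹ • (x - y)) ((2 : ℝ)⁻¹ • (x + y))) :
    (∀ (x y : X) (a b : 𝕜), ‖a + b‖ ≤ ‖a - b‖ →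
       ConcaveOn ℝ Set.univ (fun z : X => V (x + a • z) (y + b • z))) ∧
    (∀ x y : X,
       ConcaveOn ℝ Set.univ (fun z : X => V (x + z) y) ∧
       ConcaveOn ℝ Set.univ (fun z : X => V x (y + z))) := by
  have key : ∀ (x y : X) (a b : 𝕜), ‖a + b‖ ≤ ‖a - b‖ →
      ConcaveOn ℝ Set.univ (fun z : X => V (x + a • z) (y + b • z)) := by
    intro x y a b hab
    have hε : ‖(a + b) / (a - b)‖ ≤ 1 := by
      rw [norm_div]
      exact div_le_one_of_le₀ hab (norm_nonneg _)
    have hmul : (a + b) / (a - b) * (a - b) = a + b := by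
      refine div_mul_cancel_of_imp fun h => ?_
      simpa [h] using hab
    have hconc := (hU ((2 : ℝ)⁻¹ • (x - y)) ((2 : ℝ)⁻¹ • (x + y)) _ hε).comp_linearMap
      ((2 : ℝ)⁻¹ • DistribSMul.toLinearMap ℝ X (a - b))
    rw [Set.preimage_univ] at hconc
    convert hconc using 1
    funext z
    simp only [hV, Function.comp_apply, LinearMap.smul_apply, DistribSMul.toLinearMap_apply]
    rw [smul_comm ((a + b) / (a - b)) (2 : ℝ)⁻¹, smul_smul ((a + b) / (a - b)), hmul]
    congr 1 <;> module
  refine ⟨key, fun x y => ⟨?_, ?_⟩⟩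
  · simpa using key x y 1 0 (by simp)
  · simpa using key x y 0 1 (by simp)
end

section
/- Let X be a finite-dimensional Banach space, p ∈ (1,∞), and let V : X × X → ℝ be a continuous biconcave function (i.e., for every x, y ∈ X the maps e ↦ V(x, e) and e ↦ V(e, y) are concave) satisfying the homogeneity V(αx, αy) = |α|^p V(x,y) for all scalars α and all x, y ∈ X. Then there exists a constant C > 0 such that at every point (x,y) ∈ X × X at which V is Fréchet differentiable in the first variable one has ‖∂_x V(x,y)‖ ≤ C (‖x‖^{p−1} + ‖y‖^{p−1}), and at every point at which V is Fréchet differentiable in the second variable one has ‖∂_y V(x,y)‖ ≤ C (‖x‖^{p−1} + ‖y‖^{p−1}). -/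
/-- A concave function lies below its tangent plane at a point of differentiability. -/
theorem ConcaveOn.sub_le_of_hasFDerivAt {E : Type*} [NormedAddCommGroup E] [NormedSpace ℝ E]
    {f : E → ℝ} (hf : ConcaveOn ℝ Set.univ f) {x : E} {L : E →L[ℝ] ℝ}
    (hL : HasFDerivAt f L x) (h : E) : f (x + h) - f x ≤ L h := by
  have hg : ConcaveOn ℝ Set.univ (fun t : ℝ => f (x + t • h)) := by
    refine ⟨convex_univ, fun s _ t _ a b ha hb hab => ?_⟩
    have key := hf.2 (Set.mem_univ (x + s • h)) (Set.mem_univ (x + t • h)) ha hb hab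
    have e : a • (x + s • h) + b • (x + t • h) = x + (a • s + b • t) • h := by
      calc a • (x + s • h) + b • (x + t • h) = (a + b) • x + (a • s + b • t) • h := by module
        _ = x + (a • s + b • t) • h := by rw [hab, one_smul]
    rwa [e] at key
  have hd : HasDerivAt (fun t : ℝ => f (x + t • h)) (L h) 0 := hL.hasLineDerivAt h
  have key := hg.slope_le_of_hasDerivAt (Set.mem_univ 0) (Set.mem_univ 1) one_pos hd
  simpa [slope_def_field] using key

/-- The derivative of a concave function bounded by `K` on a closed ball of radius `r` has norm
at most `2 * K / r` at the centre. -/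
theorem ConcaveOn.norm_le_of_hasFDerivAt {E : Type*} [NormedAddCommGroup E] [NormedSpace ℝ E]
    {f : E → ℝ} (hf : ConcaveOn ℝ Set.univ f) {x : E} {L : E →L[ℝ] ℝ}
    (hL : HasFDerivAt f L x) {K r : ℝ} (hr : 0 < r)
    (hK : ∀ h : E, ‖h‖ ≤ r → |f (x + h)| ≤ K) : ‖L‖ ≤ 2 * K / r := by
  have hx : |f x| ≤ K := by simpa using hK 0 (by simpa using hr.le)
  have hlow (h : E) (hh : ‖h‖ ≤ r) : -(2 * K) ≤ L h := by
    have := hf.sub_le_of_hasFDerivAt hL h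
    linarith [(abs_le.1 (hK h hh)).1, (abs_le.1 hx).2]
  have hK0 : 0 ≤ K := (abs_nonneg _).trans hx
  refine ContinuousLinearMap.opNorm_le_of_unit_norm (by positivity) fun u hu => ?_
  have hru : ‖r • u‖ ≤ r := by rw [norm_smul, hu, mul_one, Real.norm_of_nonneg hr.le]
  have hpos := hlow (r • u) hru
  have hneg := hlow (-(r • u)) (by rwa [norm_neg])
  rw [map_neg] at hneg
  rw [map_smul, smul_eq_mul] at hpos hneg
  rw [le_div_iff₀ hr, Real.norm_eq_abs, ← abs_of_pos hr, ← abs_mul, abs_le]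
  constructor <;> linarith

/-- The bound for the derivative in the first variable of a homogeneous function that is concave
in that variable. -/
theorem exists_norm_hasFDerivAt_le_of_homogeneous
    {X : Type*} [NormedAddCommGroup X] [NormedSpace ℝ X] [FiniteDimensional ℝ X]
    {p : ℝ} (hp : 1 < p) {V : X → X → ℝ}
    (hcont : Continuous fun q : X × X => V q.1 q.2)
    (hconc : ∀ y : X, ConcaveOn ℝ Set.univ fun x : X => V x y)
    (hhom : ∀ (α : ℝ) (x y : X), V (α • x) (α • y) = |α| ^ p * V x y) :
    ∃ C : ℝ, 0 < C ∧ ∀ (x y : X) (L : X →L[ℝ] ℝ), HasFDerivAt (fun u : X => V u y) L x →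
      ‖L‖ ≤ C * (‖x‖ ^ (p - 1) + ‖y‖ ^ (p - 1)) := by
  have : ProperSpace (X × X) := FiniteDimensional.proper ℝ _
  obtain ⟨M, hM⟩ := (isCompact_closedBall (0 : X × X) 2).exists_bound_of_continuousOn
    hcont.continuousOn
  have hM0 : 0 ≤ M := (norm_nonneg _).trans (hM 0 (by simp))
  refine ⟨2 * M + 1, by linarith, fun x y L hL => ?_⟩
  have hscale (r : ℝ) (hr : max ‖x‖ ‖y‖ < r) : ‖L‖ ≤ (2 * M + 1) * r ^ (p - 1) := by
    obtain ⟨hx, hy⟩ := max_lt_iff.1 hr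
    have hr0 : 0 < r := (norm_nonneg x).trans_lt hx
    have hbound (h : X) (hh : ‖h‖ ≤ r) : |V (x + h) y| ≤ M * r ^ p := by
      have hnorm (z : X) (hz : ‖z‖ ≤ 2 * r) : ‖r⁻¹ • z‖ ≤ 2 := by
        rw [norm_smul, norm_inv, Real.norm_of_nonneg hr0.le, inv_mul_le_iff₀ hr0]
        linarith
      have hmem : (r⁻¹ • (x + h), r⁻¹ • y) ∈ Metric.closedBall (0 : X × X) 2 := by
        rw [mem_closedBall_zero_iff, Prod.norm_def]
        exact max_le (hnorm _ (by linarith [norm_add_le x h])) (hnorm _ (by linarith))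
      have heq := hhom r (r⁻¹ • (x + h)) (r⁻¹ • y)
      rw [smul_inv_smul₀ hr0.ne', smul_inv_smul₀ hr0.ne', abs_of_pos hr0] at heq
      rw [heq, abs_mul, abs_of_pos (Real.rpow_pos_of_pos hr0 p), mul_comm]
      exact mul_le_mul_of_nonneg_right (hM _ hmem) (Real.rpow_nonneg hr0.le p)
    calc ‖L‖ ≤ 2 * (M * r ^ p) / r := (hconc y).norm_le_of_hasFDerivAt hL hr0 hbound
      _ = 2 * M * r ^ (p - 1) := by rw [Real.rpow_sub_one hr0.ne']; ring
      _ ≤ (2 * M + 1) * r ^ (p - 1) :=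
        mul_le_mul_of_nonneg_right (by linarith) (Real.rpow_nonneg hr0.le _)
  have hlim : ‖L‖ ≤ (2 * M + 1) * max ‖x‖ ‖y‖ ^ (p - 1) := by
    have hc : Continuous fun r : ℝ => (2 * M + 1) * r ^ (p - 1) :=
      continuous_const.mul (Real.continuous_rpow_const (by linarith))
    exact ge_of_tendsto (hc.continuousWithinAt (s := Set.Ioi (max ‖x‖ ‖y‖)))
      (eventually_nhdsWithin_of_forall hscale)
  refine hlim.trans (mul_le_mul_of_nonneg_left ?_ (by linarith))
  have hx0 := Real.rpow_nonneg (norm_nonneg x) (p - 1)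
  have hy0 := Real.rpow_nonneg (norm_nonneg y) (p - 1)
  rcases max_choice ‖x‖ ‖y‖ with h | h <;> rw [h] <;> linarith

/-- Let `X` be a finite-dimensional Banach space and `V : X × X → ℝ` a continuous biconcave
function satisfying `V(αx, αy) = |α|^p V(x,y)`. Then there is a constant `C > 0` such that at
every point of Fréchet differentiability in the first (resp. second) variable, the derivative
satisfies `‖∂_x V(x,y)‖ ≤ C (‖x‖^{p-1} + ‖y‖^{p-1})` (resp. for `∂_y V`). -/
theorem burkholder_function_derivative_bound
    {X : Type*} [NormedAddCommGroup X] [NormedSpace ℝ X] [FiniteDimensional ℝ X]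
    (p : ℝ) (hp : 1 < p) (V : X → X → ℝ)
    (hcont : Continuous fun q : X × X => V q.1 q.2)
    (hconc1 : ∀ y : X, ConcaveOn ℝ Set.univ fun x : X => V x y)
    (hconc2 : ∀ x : X, ConcaveOn ℝ Set.univ fun y : X => V x y)
    (hhom : ∀ (α : ℝ) (x y : X), V (α • x) (α • y) = |α| ^ p * V x y) :
    ∃ C : ℝ, 0 < C ∧
      (∀ (x y : X) (L : X →L[ℝ] ℝ), HasFDerivAt (fun u : X => V u y) L x →
        ‖L‖ ≤ C * (‖x‖ ^ (p - 1) + ‖y‖ ^ (p - 1))) ∧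
      (∀ (x y : X) (L : X →L[ℝ] ℝ), HasFDerivAt (fun u : X => V x u) L y →
        ‖L‖ ≤ C * (‖x‖ ^ (p - 1) + ‖y‖ ^ (p - 1))) := by
  obtain ⟨C₁, hC₁, h₁⟩ := exists_norm_hasFDerivAt_le_of_homogeneous hp hcont hconc1 hhom
  obtain ⟨C₂, hC₂, h₂⟩ := exists_norm_hasFDerivAt_le_of_homogeneous (V := fun y x => V x y) hp
    (hcont.comp continuous_swap) hconc2 (fun α y x => hhom α x y)
  have hnonneg (x y : X) : 0 ≤ ‖x‖ ^ (p - 1) + ‖y‖ ^ (p - 1) := by positivity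
  refine ⟨max C₁ C₂, lt_max_of_lt_left hC₁, fun x y L hL => ?_, fun x y L hL => ?_⟩
  · exact (h₁ x y L hL).trans
      (mul_le_mul_of_nonneg_right (le_max_left _ _) (hnonneg x y))
  · refine (h₂ y x L hL).trans ?_
    rw [add_comm]
    exact mul_le_mul_of_nonneg_right (le_max_right _ _) (hnonneg x y)
end
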